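/- arXiv:2410.06266 — 2 statements merged into one kernel-verified Lean document; each statement's English description precedes it below -/
import Mathlib

section
/- Let σ > 0, let n, p, k be positive integers, let c_1, …, c_k ∈ ℝ^{n×p} be matrices and c′_1, …, c′_k ∈ ℝ^n be vectors such that ‖c_i[j,:]‖₂ ≤ c′_i(j) for all i ∈ {1,…,k} and j ∈ {1,…,n}, and let p_1, …, p_k ≥ 0 with Σ_i p_i = 1. Define P = N(0, σ²·I_{np}) and Q = Σ_i p_i·N(vec(c_i), σ²·I_{np}) on ℝ^{n×p} ≅ ℝ^{np}, and P′ = N(0, σ²·I_n) and Q′ = Σ_i p_i·N(c′_i, σ²·I_n) on ℝ^n. Then for every α ≥ 0, H_α(P,Q) ≤ H_α(P′,Q′). -/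
open MeasureTheory

/-- The density of the Gaussian `N(m, σ²·I_d)` with respect to Lebesgue measure on `ℝ^d`. -/
noncomputable def gaussDensity (d : ℕ) (σ : ℝ) (m x : EuclideanSpace ℝ (Fin d)) : ℝ :=
  (2 * Real.pi * σ ^ 2) ^ (-(d : ℝ) / 2) * Real.exp (-‖x - m‖ ^ 2 / (2 * σ ^ 2))

/-- The flattening `vec : ℝ^{n×p} → ℝ^{np}` of a matrix. -/
noncomputable def vec {n p : ℕ} (M : Matrix (Fin n) (Fin p) ℝ) :
    EuclideanSpace ℝ (Fin (n * p)) :=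
  (EuclideanSpace.equiv (Fin (n * p)) ℝ).symm fun t =>
    M (finProdFinEquiv.symm t).1 (finProdFinEquiv.symm t).2

open ProbabilityTheory
open scoped NNReal ENNReal

/-- Peeling off the first coordinate of an integral over a finite power. -/
lemma lintegral_fin_succ {X : Type*} [MeasureSpace X] [SigmaFinite (volume : Measure X)] {n : ℕ}
    {f : (Fin (n + 1) → X) → ℝ≥0∞} (hf : Measurable f) :
    ∫⁻ x, f x = ∫⁻ a, ∫⁻ y, f (Fin.cons a y) := by
  have h := (volume_preserving_piFinSuccAbove (fun _ : Fin (n + 1) => X) 0).symm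
  rw [← h.lintegral_comp hf]
  have hm : Measurable fun z : X × (Fin n → X) =>
      f ((MeasurableEquiv.piFinSuccAbove (fun _ : Fin (n + 1) => X) 0).symm z) := by fun_prop
  rw [Measure.volume_eq_prod, lintegral_prod _ hm.aemeasurable]
  simp [MeasurableEquiv.piFinSuccAbove, Fin.insertNthEquiv]

lemma lintegral_fin_prod {d : ℕ} {f : Fin d → ℝ → ℝ≥0∞} (hf : ∀ i, Measurable (f i)) :
    ∫⁻ x : Fin d → ℝ, ∏ i, f i (x i) = ∏ i, ∫⁻ t, f i t := by
  induction d with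
  | zero => simp [volume_pi]
  | succ d ih =>
    rw [lintegral_fin_succ (by fun_prop)]
    simp only [Fin.prod_univ_succ, Fin.cons_zero, Fin.cons_succ]
    have : ∀ a, ∫⁻ y : Fin d → ℝ, f 0 a * ∏ i : Fin d, f i.succ (y i) =
        f 0 a * ∏ i : Fin d, ∫⁻ t, f i.succ t := fun a => by
      rw [lintegral_const_mul _ (by fun_prop), ih fun i => hf i.succ]
    simp_rw [this]
    rw [lintegral_mul_const _ (hf 0)]

lemma withDensity_fin_prod {d : ℕ} {f : Fin d → ℝ → ℝ≥0∞} (hf : ∀ i, Measurable (f i))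
    [∀ i, SigmaFinite ((volume : Measure ℝ).withDensity (f i))] :
    (volume : Measure (Fin d → ℝ)).withDensity (fun x => ∏ i, f i (x i)) =
      Measure.pi fun i => volume.withDensity (f i) := by
  symm
  refine Measure.pi_eq fun s hs => ?_
  rw [withDensity_apply _ (.univ_pi hs), ← lintegral_indicator (.univ_pi hs)]
  have : (Set.univ.pi s).indicator (fun x : Fin d → ℝ => ∏ i, f i (x i)) =
      fun x => ∏ i, (s i).indicator (f i) (x i) := by
    ext x
    by_cases hx : x ∈ Set.univ.pi s
    · rw [Set.indicator_of_mem hx]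
      exact Finset.prod_congr rfl fun i _ => (Set.indicator_of_mem (hx i trivial) _).symm
    · rw [Set.indicator_of_notMem hx]
      simp only [Set.mem_pi, Set.mem_univ, true_implies, not_forall] at hx
      obtain ⟨i, hi⟩ := hx
      exact (Finset.prod_eq_zero (Finset.mem_univ i) (Set.indicator_of_notMem hi _)).symm
  rw [this, lintegral_fin_prod fun i => (hf i).indicator (hs i)]
  refine Finset.prod_congr rfl fun i _ => ?_
  rw [withDensity_apply _ (hs i), lintegral_indicator (hs i)]

/-- The density of a product of Gaussians with means `m i` and common variance `V`. -/
noncomputable def gaussProd {d : ℕ} (V : ℝ≥0) (m x : Fin d → ℝ) : ℝ :=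
  ∏ i, gaussianPDFReal (m i) V (x i)

@[fun_prop]
lemma measurable_gaussianPDFReal_comp {X : Type*} [MeasurableSpace X] (m : ℝ) (V : ℝ≥0)
    {f : X → ℝ} (hf : Measurable f) : Measurable fun x => gaussianPDFReal m V (f x) :=
  (measurable_gaussianPDFReal m V).comp hf

@[fun_prop]
lemma measurable_gaussProd {X : Type*} [MeasurableSpace X] {d : ℕ} (V : ℝ≥0) (m : Fin d → ℝ)
    {f : X → Fin d → ℝ} (hf : Measurable f) : Measurable fun x => gaussProd V m (f x) := by
  unfold gaussProd
  fun_prop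

lemma gaussProd_nonneg {d : ℕ} (V : ℝ≥0) (m x : Fin d → ℝ) : 0 ≤ gaussProd V m x :=
  Finset.prod_nonneg fun _ _ => gaussianPDFReal_nonneg _ _ _

lemma gaussProd_pos {d : ℕ} {V : ℝ≥0} (hV : V ≠ 0) (m x : Fin d → ℝ) : 0 < gaussProd V m x :=
  Finset.prod_pos fun _ _ => gaussianPDFReal_pos _ _ _ hV

lemma gaussProd_cons {d : ℕ} (V : ℝ≥0) (m : Fin (d + 1) → ℝ) (a : ℝ) (x : Fin d → ℝ) :
    gaussProd V m (Fin.cons a x : Fin (d + 1) → ℝ) =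
      gaussianPDFReal (m 0) V a * gaussProd V (fun i => m i.succ) x := by
  simp [gaussProd, Fin.prod_univ_succ]

lemma gaussProd_eq {d : ℕ} (V : ℝ≥0) (m x : Fin d → ℝ) :
    gaussProd V m x = (√(2 * Real.pi * V))⁻¹ ^ d *
      Real.exp (-(∑ i, (x i - m i) ^ 2) / (2 * V)) := by
  simp only [gaussProd, gaussianPDFReal, Finset.prod_mul_distrib, Finset.prod_const,
    Finset.card_univ, Fintype.card_fin, ← Real.exp_sum, ← Finset.sum_div, Finset.sum_neg_distrib]

lemma withDensity_gaussProd {d : ℕ} {V : ℝ≥0} (hV : V ≠ 0) (m : Fin d → ℝ) :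
    volume.withDensity (fun x => ENNReal.ofReal (gaussProd V m x)) =
      Measure.pi fun i => gaussianReal (m i) V := by
  have key : ∀ i, gaussianReal (m i) V = volume.withDensity (gaussianPDF (m i) V) :=
    fun i => gaussianReal_of_var_ne_zero _ hV
  have : ∀ i, SigmaFinite ((volume : Measure ℝ).withDensity (gaussianPDF (m i) V)) :=
    fun i => by rw [← key]; infer_instance
  simp_rw [key]
  rw [← withDensity_fin_prod fun i => measurable_gaussianPDF _ _]
  congr with x
  rw [gaussProd, ENNReal.ofReal_prod_of_nonneg fun _ _ => gaussianPDFReal_nonneg _ _ _]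
  rfl

/-- The law of a coordinate along a unit vector under a product of Gaussians. -/
lemma map_pi_gaussianReal_unit {d : ℕ} (V : ℝ≥0) (m e : Fin d → ℝ) (he : ∑ i, e i ^ 2 = 1) :
    (Measure.pi fun i => gaussianReal (m i) V).map (fun x => ∑ i, e i * x i) =
      gaussianReal (∑ i, e i * m i) V := by
  have hmeas : Measurable fun x : Fin d → ℝ => ∑ i, e i * x i := by fun_prop
  have := Measure.isProbabilityMeasure_map
    (μ := Measure.pi fun i => gaussianReal (m i) V) hmeas.aemeasurable
  apply Measure.ext_of_charFun
  ext s
  rw [charFun_apply_real, integral_map hmeas.aemeasurable (by fun_prop), charFun_gaussianReal]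
  have h1 : ∀ x : Fin d → ℝ, Complex.exp (s * ((∑ i, e i * x i : ℝ) : ℂ) * Complex.I) =
      ∏ i, Complex.exp (((s * e i : ℝ) : ℂ) * x i * Complex.I) := fun x => by
    rw [← Complex.exp_sum]
    push_cast
    rw [Finset.mul_sum, Finset.sum_mul]
    simp only [mul_assoc]
  simp_rw [h1]
  rw [integral_fintype_prod_eq_prod
    (f := fun i (t : ℝ) => Complex.exp (((s * e i : ℝ) : ℂ) * t * Complex.I))]
  simp_rw [← charFun_apply_real, charFun_gaussianReal, ← Complex.exp_sum]
  congr 1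
  have h2 : ∑ i, (e i : ℂ) ^ 2 = 1 := by exact_mod_cast he
  rw [Finset.sum_sub_distrib]
  push_cast
  congr 1
  · rw [Finset.mul_sum, Finset.sum_mul]
    exact Finset.sum_congr rfl fun i _ => by ring
  · calc ∑ i, (V : ℂ) * (s * e i) ^ 2 / 2 = (V * s ^ 2 / 2) * ∑ i, (e i : ℂ) ^ 2 := by
          rw [Finset.mul_sum]
          exact Finset.sum_congr rfl fun i _ => by ring
      _ = _ := by rw [h2, mul_one]

lemma gaussianReal_Iic_antitone (V : ℝ≥0) (s : ℝ) {a b : ℝ} (hab : b ≤ a) :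
    gaussianReal a V (Set.Iic s) ≤ gaussianReal b V (Set.Iic s) := by
  have h : gaussianReal a V = (gaussianReal b V).map (· + (a - b)) := by
    rw [gaussianReal_map_add_const]; congr 1; ring
  rw [h, Measure.map_apply (by fun_prop) measurableSet_Iic]
  refine measure_mono fun x hx => ?_
  simp only [Set.mem_preimage, Set.mem_Iic] at hx ⊢
  linarith

/-- Neyman–Pearson: a set `H` on which `f ≤ L * g` and off which `L * g ≤ f` has the least
`f`-mass among the sets with the same `g`-mass. -/
lemma withDensity_le_of_likelihood_ratio {X : Type*} [MeasurableSpace X] {μ : Measure X}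
    {f g : X → ℝ≥0∞} (hg : Measurable g) [IsFiniteMeasure (μ.withDensity g)] {L : ℝ≥0∞}
    {H S : Set X} (hH : MeasurableSet H) (hS : MeasurableSet S)
    (hle : ∀ x ∈ H, f x ≤ L * g x) (hge : ∀ x ∉ H, L * g x ≤ f x)
    (hHS : μ.withDensity g H = μ.withDensity g S) :
    μ.withDensity f H ≤ μ.withDensity f S := by
  have hdiff : μ.withDensity g (H \ S) = μ.withDensity g (S \ H) := by
    have h1 := measure_inter_add_sdiff (μ := μ.withDensity g) H hS
    have h2 := measure_inter_add_sdiff (μ := μ.withDensity g) S hH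
    rw [Set.inter_comm] at h2
    rw [← h2, ← h1] at hHS
    exact (ENNReal.add_right_inj (measure_ne_top _ _)).1 hHS
  rw [← measure_inter_add_sdiff H hS, ← measure_inter_add_sdiff S hH, Set.inter_comm S H]
  gcongr 1
  calc μ.withDensity f (H \ S) = ∫⁻ x in H \ S, f x ∂μ := withDensity_apply _ (hH.diff hS)
    _ ≤ ∫⁻ x in H \ S, L * g x ∂μ := setLIntegral_mono' (hH.diff hS) fun x hx => hle x hx.1
    _ = L * μ.withDensity g (H \ S) := by
      rw [lintegral_const_mul _ hg, withDensity_apply _ (hH.diff hS)]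
    _ = L * μ.withDensity g (S \ H) := by rw [hdiff]
    _ = ∫⁻ x in S \ H, L * g x ∂μ := by
      rw [lintegral_const_mul _ hg, withDensity_apply _ (hS.diff hH)]
    _ ≤ ∫⁻ x in S \ H, f x ∂μ := setLIntegral_mono' (hS.diff hH) fun x hx => hge x hx.2
    _ = μ.withDensity f (S \ H) := (withDensity_apply _ (hS.diff hH)).symm

/-- Among the sets of given Gaussian measure, half-spaces have the least mass after a shift. -/
lemma gaussianReal_Iic_le_pi_of_measure_eq {d : ℕ} {V : ℝ≥0} (hV : V ≠ 0) {S : Set (Fin d → ℝ)}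
    (hS : MeasurableSet S) {s : ℝ}
    (hs : gaussianReal 0 V (Set.Iic s) = (Measure.pi fun _ => gaussianReal 0 V) S)
    (v : Fin d → ℝ) {a : ℝ} (ha : √(∑ i, v i ^ 2) ≤ a) :
    gaussianReal a V (Set.Iic s) ≤ (Measure.pi fun i => gaussianReal (v i) V) S := by
  refine (gaussianReal_Iic_antitone V s ha).trans ?_
  have hnn : 0 ≤ ∑ i, v i ^ 2 := Finset.sum_nonneg fun i _ => sq_nonneg _
  obtain ⟨b, hb⟩ : ∃ b, b = √(∑ i, v i ^ 2) := ⟨_, rfl⟩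
  have hb2 : b ^ 2 = ∑ i, v i ^ 2 := by rw [hb, Real.sq_sqrt hnn]
  rw [← hb]
  rcases eq_or_lt_of_le (hb ▸ Real.sqrt_nonneg _ : 0 ≤ b) with h0 | hbpos
  · have hv : ∀ i, v i = 0 := fun i => by
      have := (Finset.sum_eq_zero_iff_of_nonneg fun i _ => sq_nonneg (v i)).1
        (by rw [← hb2, ← h0]; norm_num) i (Finset.mem_univ i)
      exact pow_eq_zero_iff two_ne_zero |>.1 this
    simp_rw [hv, ← h0]
    exact hs.le
  have hunit : ∑ i, (v i / b) ^ 2 = 1 := by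
    simp_rw [div_pow]
    rw [← Finset.sum_div, ← hb2, div_self (by positivity)]
  have hmeas : Measurable fun x : Fin d → ℝ => ∑ i, v i / b * x i := by fun_prop
  have hH : ∀ m : Fin d → ℝ, (Measure.pi fun i => gaussianReal (m i) V)
      {x | ∑ i, v i / b * x i ≤ s} = gaussianReal (∑ i, v i / b * m i) V (Set.Iic s) := fun m => by
    rw [← map_pi_gaussianReal_unit V m _ hunit, Measure.map_apply hmeas measurableSet_Iic]
    rfl
  have hmean : ∑ i, v i / b * v i = b := by
    have : ∀ i, v i / b * v i = v i ^ 2 / b := fun i => by ring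
    simp_rw [this]
    rw [← Finset.sum_div, ← hb2]
    field_simp
  have hH0 := hH 0
  have hHv := hH v
  simp only [Pi.zero_apply, mul_zero, Finset.sum_const_zero] at hH0
  rw [hmean] at hHv
  rw [← hHv]
  have h0eq := withDensity_gaussProd hV (0 : Fin d → ℝ)
  simp only [Pi.zero_apply] at h0eq
  rw [← h0eq] at hs hH0
  have : IsFiniteMeasure (volume.withDensity
      fun x => ENNReal.ofReal (gaussProd V (0 : Fin d → ℝ) x)) := by
    rw [h0eq]; infer_instance
  rw [← withDensity_gaussProd hV v]
  have hratio : ∀ x : Fin d → ℝ, gaussProd V v x =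
      Real.exp ((2 * b * (∑ i, v i / b * x i) - b ^ 2) / (2 * V)) * gaussProd V 0 x := fun x => by
    rw [gaussProd_eq, gaussProd_eq, mul_left_comm, ← Real.exp_add]
    congr 2
    rw [← add_div]
    congr 1
    rw [hb2, Finset.mul_sum, ← Finset.sum_sub_distrib, ← Finset.sum_neg_distrib,
      ← Finset.sum_neg_distrib, ← Finset.sum_add_distrib]
    refine Finset.sum_congr rfl fun i _ => ?_
    simp only [Pi.zero_apply]
    field_simp
    ring
  have hVpos : (0 : ℝ) < V := by positivity
  refine withDensity_le_of_likelihood_ratio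
    (L := ENNReal.ofReal (Real.exp ((2 * b * s - b ^ 2) / (2 * V)))) (by fun_prop)
    (measurableSet_le hmeas measurable_const) hS (fun x hx => ?_) (fun x hx => ?_)
    (hH0.trans hs)
  · rw [← ENNReal.ofReal_mul (Real.exp_nonneg _), hratio]
    have := gaussProd_nonneg V 0 x
    simp only [Set.mem_ofPred_eq] at hx
    gcongr
  · rw [← ENNReal.ofReal_mul (Real.exp_nonneg _), hratio]
    have := gaussProd_nonneg V 0 x
    simp only [Set.mem_ofPred_eq, not_le] at hx
    gcongr

lemma exists_gaussianReal_Iic_eq {V : ℝ≥0} (hV : V ≠ 0) {T : ℝ≥0∞} (h0 : T ≠ 0) (h1 : T < 1) :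
    ∃ s, gaussianReal 0 V (Set.Iic s) = T := by
  have := nullSingletonClass_gaussianReal (μ := 0) hV
  have hcont : Continuous (cdf (gaussianReal 0 V)) := by
    rw [continuous_iff_continuousAt]
    intro x
    rw [(monotone_cdf _).continuousAt_iff_leftLim_eq_rightLim, StieltjesFunction.rightLim_eq]
    have h := (cdf (gaussianReal 0 V)).measure_singleton x
    rw [measure_cdf, measure_singleton] at h
    have := ENNReal.ofReal_eq_zero.1 h.symm
    exact le_antisymm ((monotone_cdf _).leftLim_le le_rfl) (by linarith)
  have hT : T ≠ ∞ := (h1.trans ENNReal.one_lt_top).ne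
  obtain ⟨s, hs⟩ := mem_range_of_exists_le_of_exists_ge hcont (c := T.toReal)
    (((tendsto_cdf_atBot _).eventually_le_const (ENNReal.toReal_pos h0 hT)).exists)
    (((tendsto_cdf_atTop _).eventually_const_le
      ((ENNReal.toReal_lt_toReal hT ENNReal.one_ne_top).2 h1)).exists)
  exact ⟨s, by rw [← ofReal_cdf, hs, ENNReal.ofReal_toReal hT]⟩

/-- Every set has a one-dimensional rearrangement of the same centred Gaussian measure whose mass
under any shift is at most that of the original set under a shorter shift. -/
lemma exists_rearrangement {d : ℕ} {V : ℝ≥0} (hV : V ≠ 0) {S : Set (Fin d → ℝ)}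
    (hS : MeasurableSet S) :
    ∃ S' : Set ℝ, MeasurableSet S' ∧
      gaussianReal 0 V S' = (Measure.pi fun _ => gaussianReal 0 V) S ∧
      ∀ (v : Fin d → ℝ) (a : ℝ), √(∑ i, v i ^ 2) ≤ a →
        gaussianReal a V S' ≤ (Measure.pi fun i => gaussianReal (v i) V) S := by
  rcases eq_or_ne ((Measure.pi fun _ : Fin d => gaussianReal 0 V) S) 0 with h0 | h0
  · exact ⟨∅, .empty, by simp [h0], by simp⟩
  rcases eq_or_lt_of_le (prob_le_one (μ := Measure.pi fun _ : Fin d => gaussianReal 0 V) (s := S))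
    with h1 | h1
  · refine ⟨Set.univ, .univ, by simp [h1], fun v a _ => ?_⟩
    have hnull := (prob_compl_eq_zero_iff hS).2 h1
    have h0eq := withDensity_gaussProd hV (0 : Fin d → ℝ)
    simp only [Pi.zero_apply] at h0eq
    rw [← h0eq] at hnull
    have hvol := withDensity_absolutelyContinuous' (by fun_prop)
      (.of_forall fun x => (ENNReal.ofReal_pos.2 (gaussProd_pos hV 0 x)).ne') hnull
    have := withDensity_absolutelyContinuous volume
      (fun x => ENNReal.ofReal (gaussProd V v x)) hvol
    rw [withDensity_gaussProd hV] at this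
    rw [(prob_compl_eq_zero_iff hS).1 this]
    exact prob_le_one
  · obtain ⟨s, hs⟩ := exists_gaussianReal_Iic_eq hV h0 h1
    exact ⟨Set.Iic s, measurableSet_Iic, hs,
      fun v a ha => gaussianReal_Iic_le_pi_of_measure_eq hV hS hs v ha⟩

lemma setIntegral_ofReal_le_lintegral {X : Type*} [MeasurableSpace X] {μ : Measure X} {f : X → ℝ}
    (hf : Integrable f μ) (S : Set X) :
    ENNReal.ofReal (∫ x in S, f x ∂μ) ≤ ∫⁻ x, ENNReal.ofReal (f x) ∂μ := by
  calc ENNReal.ofReal (∫ x in S, f x ∂μ) ≤ ENNReal.ofReal (∫ x in S, max (f x) 0 ∂μ) :=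
        ENNReal.ofReal_le_ofReal (integral_mono hf.integrableOn hf.pos_part.integrableOn
          fun x => le_max_left _ _)
    _ = ∫⁻ x in S, ENNReal.ofReal (max (f x) 0) ∂μ :=
        ofReal_integral_eq_lintegral_ofReal hf.pos_part.integrableOn
          (.of_forall fun x => le_max_right _ _)
    _ ≤ ∫⁻ x, ENNReal.ofReal (max (f x) 0) ∂μ := setLIntegral_le_lintegral _ _
    _ = ∫⁻ x, ENNReal.ofReal (f x) ∂μ := by simp [ENNReal.ofReal_max]

lemma lintegral_ofReal_eq_setIntegral {X : Type*} [MeasurableSpace X] {μ : Measure X} {f : X → ℝ}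
    (hf : Integrable f μ) (hm : Measurable f) :
    ∫⁻ x, ENNReal.ofReal (f x) ∂μ = ENNReal.ofReal (∫ x in {x | 0 < f x}, f x ∂μ) := by
  have hS : MeasurableSet {x | 0 < f x} := measurableSet_lt measurable_const hm
  rw [ofReal_integral_eq_lintegral_ofReal hf.integrableOn
    ((ae_restrict_iff' hS).2 (.of_forall fun x hx => le_of_lt hx)), ← lintegral_indicator hS]
  refine lintegral_congr fun x => ?_
  by_cases hx : 0 < f x
  · exact (Set.indicator_of_mem (s := {x | 0 < f x}) hx fun x => ENNReal.ofReal (f x)).symm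
  · rw [Set.indicator_of_notMem (s := {x | 0 < f x}) hx, ENNReal.ofReal_of_nonpos (not_lt.1 hx)]

lemma integrable_of_withDensity_ofReal {X : Type*} [MeasurableSpace X] {μ ν : Measure X}
    [IsFiniteMeasure ν] {f : X → ℝ} (hm : Measurable f) (h0 : ∀ x, 0 ≤ f x)
    (h : μ.withDensity (fun x => ENNReal.ofReal (f x)) = ν) : Integrable f μ := by
  refine ⟨hm.aestronglyMeasurable, ?_⟩
  rw [hasFiniteIntegral_iff_ofReal (.of_forall h0), ← setLIntegral_univ,
    ← withDensity_apply _ .univ, h]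
  exact measure_lt_top _ _

lemma setIntegral_of_withDensity_ofReal {X : Type*} [MeasurableSpace X] {μ ν : Measure X}
    {f : X → ℝ} (hm : Measurable f) (h0 : ∀ x, 0 ≤ f x)
    (h : μ.withDensity (fun x => ENNReal.ofReal (f x)) = ν) {S : Set X} (hS : MeasurableSet S) :
    ∫ x in S, f x ∂μ = ν.real S := by
  rw [integral_eq_lintegral_of_nonneg_ae (.of_forall h0) hm.aestronglyMeasurable,
    ← withDensity_apply _ hS, h, Measure.real]

lemma withDensity_gaussianPDFReal {V : ℝ≥0} (hV : V ≠ 0) (m : ℝ) :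
    volume.withDensity (fun x => ENNReal.ofReal (gaussianPDFReal m V x)) = gaussianReal m V :=
  (gaussianReal_of_var_ne_zero _ hV).symm

lemma integrable_gaussProd {d : ℕ} {V : ℝ≥0} (hV : V ≠ 0) (m : Fin d → ℝ) :
    Integrable (gaussProd V m) :=
  integrable_of_withDensity_ofReal (by fun_prop) (gaussProd_nonneg V m) (withDensity_gaussProd hV m)

lemma setIntegral_sub_sum {X ι : Type*} [MeasurableSpace X] [Fintype ι] {μ : Measure X}
    {f : X → ℝ} {g : ι → X → ℝ} (hf : Integrable f μ) (hg : ∀ i, Integrable (g i) μ) (B : ℝ)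
    (A : ι → ℝ) (S : Set X) :
    ∫ x in S, (B * f x - ∑ i, A i * g i x) ∂μ =
      B * ∫ x in S, f x ∂μ - ∑ i, A i * ∫ x in S, g i x ∂μ := by
  rw [integral_sub (hf.integrableOn.const_mul B)
    (integrable_finsetSum _ fun i _ => (hg i).integrableOn.const_mul (A i)), integral_const_mul,
    integral_finsetSum _ fun i _ => (hg i).integrableOn.const_mul (A i)]
  simp only [integral_const_mul]

/-- Dimension reduction for a single row. -/
lemma lintegral_row_le {ι : Type*} [Fintype ι] {d : ℕ} {V : ℝ≥0} (hV : V ≠ 0) (B : ℝ) {A : ι → ℝ}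
    (hA : ∀ i, 0 ≤ A i) (v : ι → Fin d → ℝ) (a : ι → ℝ) (hva : ∀ i, √(∑ t, v i t ^ 2) ≤ a i) :
    ∫⁻ x : Fin d → ℝ, ENNReal.ofReal (B * gaussProd V 0 x -
        ∑ i, A i * gaussProd V (v i) x) ≤
      ∫⁻ y : ℝ, ENNReal.ofReal (B * gaussianPDFReal 0 V y -
        ∑ i, A i * gaussianPDFReal (a i) V y) := by
  have hf : Integrable fun x : Fin d → ℝ =>
      B * gaussProd V 0 x - ∑ i, A i * gaussProd V (v i) x :=
    ((integrable_gaussProd hV 0).const_mul B).sub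
      (integrable_finsetSum _ fun i _ => (integrable_gaussProd hV (v i)).const_mul (A i))
  have hf' : Integrable fun y : ℝ =>
      B * gaussianPDFReal 0 V y - ∑ i, A i * gaussianPDFReal (a i) V y :=
    ((integrable_gaussianPDFReal 0 V).const_mul B).sub
      (integrable_finsetSum _ fun i _ => (integrable_gaussianPDFReal (a i) V).const_mul (A i))
  have hm : Measurable fun x : Fin d → ℝ =>
      B * gaussProd V 0 x - ∑ i, A i * gaussProd V (v i) x := by fun_prop
  obtain ⟨S, hSdef⟩ : ∃ S, S = {x : Fin d → ℝ |
    0 < B * gaussProd V 0 x - ∑ i, A i * gaussProd V (v i) x} := ⟨_, rfl⟩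
  have hS : MeasurableSet S := hSdef ▸ measurableSet_lt measurable_const hm
  obtain ⟨S', hS', h0, hle⟩ := exists_rearrangement hV hS
  rw [lintegral_ofReal_eq_setIntegral hf hm, ← hSdef]
  refine le_trans (ENNReal.ofReal_le_ofReal ?_) (setIntegral_ofReal_le_lintegral hf' S')
  rw [setIntegral_sub_sum (integrable_gaussProd hV 0) fun i => integrable_gaussProd hV (v i),
    setIntegral_sub_sum (integrable_gaussianPDFReal 0 V)
      fun i => integrable_gaussianPDFReal (a i) V]
  have hx : ∀ m : Fin d → ℝ, ∫ x in S, gaussProd V m x =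
      (Measure.pi fun i => gaussianReal (m i) V).real S := fun m =>
    setIntegral_of_withDensity_ofReal (by fun_prop) (gaussProd_nonneg V m)
      (withDensity_gaussProd hV m) hS
  have hy : ∀ m : ℝ, ∫ y in S', gaussianPDFReal m V y = (gaussianReal m V).real S' := fun m =>
    setIntegral_of_withDensity_ofReal (by fun_prop) (gaussianPDFReal_nonneg m V)
      (withDensity_gaussianPDFReal hV m) hS'
  simp only [hx, hy, Measure.real, h0, Pi.zero_apply]
  gcongr with i
  · exact hA i
  · exact measure_ne_top _ _
  · exact hle _ _ (hva i)

/-- Dimension reduction, one row after the other. -/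
lemma lintegral_rows_le {ι : Type*} [Fintype ι] {n d : ℕ} {V : ℝ≥0} (hV : V ≠ 0) (B : ℝ)
    {A : ι → ℝ} (hA : ∀ i, 0 ≤ A i) (v : ι → Fin n → Fin d → ℝ) (a : ι → Fin n → ℝ)
    (hva : ∀ i j, √(∑ t, v i j t ^ 2) ≤ a i j) :
    ∫⁻ x : Fin n → Fin d → ℝ, ENNReal.ofReal (B * ∏ j, gaussProd V 0 (x j) -
        ∑ i, A i * ∏ j, gaussProd V (v i j) (x j)) ≤
      ∫⁻ y : Fin n → ℝ, ENNReal.ofReal (B * gaussProd V 0 y -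
        ∑ i, A i * gaussProd V (a i) y) := by
  induction n generalizing B A with
  | zero => simp [volume_pi, gaussProd]
  | succ n ih =>
    rw [lintegral_fin_succ (by fun_prop), lintegral_fin_succ (by fun_prop)]
    simp only [gaussProd_cons, Fin.prod_univ_succ, Fin.cons_zero, Fin.cons_succ, Pi.zero_apply,
      ← mul_assoc]
    calc _ ≤ ∫⁻ x0 : Fin d → ℝ, ∫⁻ y : Fin n → ℝ,
          ENNReal.ofReal (B * gaussProd V 0 x0 * gaussProd V 0 y -
            ∑ i, A i * gaussProd V (v i 0) x0 * gaussProd V (fun j => a i j.succ) y) :=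
          lintegral_mono fun x0 => ih (B * gaussProd V 0 x0)
            (fun i => mul_nonneg (hA i) (gaussProd_nonneg _ _ _))
            (fun i j => v i j.succ) (fun i j => a i j.succ) fun i j => hva i j.succ
      _ = ∫⁻ y : Fin n → ℝ, ∫⁻ x0 : Fin d → ℝ,
          ENNReal.ofReal (B * gaussProd V 0 x0 * gaussProd V 0 y -
            ∑ i, A i * gaussProd V (v i 0) x0 * gaussProd V (fun j => a i j.succ) y) :=
          lintegral_lintegral_swap (Measurable.aemeasurable (by fun_prop))
      _ ≤ ∫⁻ y : Fin n → ℝ, ∫⁻ y0 : ℝ,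
          ENNReal.ofReal (B * gaussianPDFReal 0 V y0 * gaussProd V 0 y -
            ∑ i, A i * gaussianPDFReal (a i 0) V y0 * gaussProd V (fun j => a i j.succ) y) := by
          refine lintegral_mono fun y => ?_
          have := lintegral_row_le hV (B * gaussProd V 0 y)
            (fun i => mul_nonneg (hA i) (gaussProd_nonneg V (fun j => a i j.succ) y))
            (fun i => v i 0) (fun i => a i 0) fun i => hva i 0
          simpa only [mul_right_comm] using this
      _ = _ := lintegral_lintegral_swap (Measurable.aemeasurable (by fun_prop))

/-- Reshaping a vector of length `n * p` into an `n × p` matrix preserves Lebesgue measure. -/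
lemma volume_preserving_flatten (n p : ℕ) :
    MeasurePreserving fun (x : Fin n → Fin p → ℝ) (t : Fin (n * p)) =>
      x (finProdFinEquiv.symm t).1 (finProdFinEquiv.symm t).2 := by
  have hm : Measurable fun (x : Fin n → Fin p → ℝ) (t : Fin (n * p)) =>
      x (finProdFinEquiv.symm t).1 (finProdFinEquiv.symm t).2 := by fun_prop
  refine ⟨hm, (Measure.pi_eq fun s hs => ?_).symm⟩
  rw [Measure.map_apply hm (.univ_pi hs)]
  have : (fun (x : Fin n → Fin p → ℝ) (t : Fin (n * p)) =>
      x (finProdFinEquiv.symm t).1 (finProdFinEquiv.symm t).2) ⁻¹' Set.univ.pi s =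
      Set.univ.pi fun j => Set.univ.pi fun t => s (finProdFinEquiv (j, t)) := by
    ext x
    simp only [Set.mem_preimage, Set.mem_pi, Set.mem_univ, true_implies]
    refine ⟨fun h j t => ?_, fun h t => ?_⟩
    · simpa using h (finProdFinEquiv (j, t))
    · have := h (finProdFinEquiv.symm t).1 (finProdFinEquiv.symm t).2
      rwa [Prod.mk.eta, Equiv.apply_symm_apply] at this
  simp_rw [this, volume_pi_pi]
  rw [← finProdFinEquiv.prod_comp, Fintype.prod_prod_type]

lemma gaussDensity_eq_gaussProd {d : ℕ} {σ : ℝ} (hσ : 0 < σ) (m x : EuclideanSpace ℝ (Fin d)) :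
    gaussDensity d σ m x = gaussProd (σ ^ 2).toNNReal m.ofLp x.ofLp := by
  have hc : (0 : ℝ) ≤ 2 * Real.pi * σ ^ 2 := by positivity
  rw [gaussDensity, gaussProd_eq, Real.coe_toNNReal _ (sq_nonneg σ), EuclideanSpace.real_norm_sq_eq]
  congr 1
  rw [Real.sqrt_eq_rpow, ← Real.rpow_neg hc, ← Real.rpow_natCast _ d, ← Real.rpow_mul hc]
  congr 1
  ring

lemma lintegral_euclideanSpace {d : ℕ} {f : (Fin d → ℝ) → ℝ≥0∞} (hf : Measurable f) :
    ∫⁻ x : EuclideanSpace ℝ (Fin d), f x.ofLp = ∫⁻ x, f x :=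
  (PiLp.volume_preserving_ofLp (Fin d)).lintegral_comp hf

/-- **Lemma 4.5 of Choquette-Choo et al. (dimension reduction for mixtures of Gaussians).**
Let `σ > 0`, let `c 1, …, c k ∈ ℝ^{n×p}` be matrices and `c' 1, …, c' k ∈ ℝ^n` vectors with
`‖c i [j,:]‖₂ ≤ c' i j` for all `i, j`, and let `w` be mixture weights. With
`P = N(0, σ²·I_{np})`, `Q = ∑ i, w i · N(vec (c i), σ²·I_{np})`, `P' = N(0, σ²·I_n)` and
`Q' = ∑ i, w i · N(c' i, σ²·I_n)`, for every `α ≥ 0` we have `H_α(P,Q) ≤ H_α(P',Q')`. -/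
theorem hockeyStick_gaussian_mixture_dimension_reduction
    (n p k : ℕ) (hn : 0 < n) (hp : 0 < p) (hk : 0 < k) (σ : ℝ) (hσ : 0 < σ)
    (c : Fin k → Matrix (Fin n) (Fin p) ℝ) (c' : Fin k → EuclideanSpace ℝ (Fin n))
    (hrow : ∀ i j, Real.sqrt (∑ t, (c i j t) ^ 2) ≤ c' i j)
    (w : Fin k → ℝ) (hw0 : ∀ i, 0 ≤ w i) (hw1 : ∑ i, w i = 1)
    (α : ℝ) (hα : 0 ≤ α) :
    (∫ x, max (gaussDensity (n * p) σ 0 x -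
        α * ∑ i, w i * gaussDensity (n * p) σ (vec (c i)) x) 0) ≤
      ∫ y, max (gaussDensity n σ 0 y - α * ∑ i, w i * gaussDensity n σ (c' i) y) 0 := by

  have hV : (σ ^ 2).toNNReal ≠ 0 := (Real.toNNReal_pos.2 (by positivity)).ne'
  simp only [gaussDensity_eq_gaussProd hσ, Finset.mul_sum, ← mul_assoc]
  generalize (σ ^ 2).toNNReal = V at hV
  have hA : ∀ i, 0 ≤ α * w i := fun i => mul_nonneg hα (hw0 i)
  rw [integral_eq_lintegral_of_nonneg_ae (.of_forall fun _ => by simp)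
      (Measurable.aestronglyMeasurable (by fun_prop)),
    integral_eq_lintegral_of_nonneg_ae (.of_forall fun _ => by simp)
      (Measurable.aestronglyMeasurable (by fun_prop))]
  simp only [ENNReal.ofReal_max, ENNReal.ofReal_zero, zero_le, sup_of_le_left]
  rw [lintegral_euclideanSpace (f := fun x => ENNReal.ofReal (gaussProd V
      (0 : EuclideanSpace ℝ (Fin (n * p))).ofLp x -
        ∑ i, α * w i * gaussProd V (vec (c i)).ofLp x)) (by fun_prop),
    lintegral_euclideanSpace (f := fun x => ENNReal.ofReal (gaussProd V
      (0 : EuclideanSpace ℝ (Fin n)).ofLp x -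
        ∑ i, α * w i * gaussProd V (c' i).ofLp x)) (by fun_prop),
    ← (volume_preserving_flatten n p).lintegral_comp (by fun_prop)]
  have hflat : ∀ (m x : Fin n → Fin p → ℝ), gaussProd V
      (fun t : Fin (n * p) => m (finProdFinEquiv.symm t).1 (finProdFinEquiv.symm t).2)
      (fun t => x (finProdFinEquiv.symm t).1 (finProdFinEquiv.symm t).2) =
      ∏ j, gaussProd V (m j) (x j) := fun m x => by
    simp only [gaussProd]
    rw [← finProdFinEquiv.prod_comp, Fintype.prod_prod_type]
    simp
  refine ENNReal.toReal_mono ?_ ?_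
  · refine ne_top_of_le_ne_top (integrable_gaussProd hV (0 : Fin n → ℝ)).lintegral_lt_top.ne
      (lintegral_mono fun y => ENNReal.ofReal_le_ofReal (sub_le_self _ ?_))
    exact Finset.sum_nonneg fun i _ => mul_nonneg (hA i) (gaussProd_nonneg _ _ _)
  · have h := lintegral_rows_le hV 1 hA (fun i => c i) (fun i => (c' i).ofLp) hrow
    simp only [one_mul] at h
    refine (lintegral_congr fun x => ?_).trans_le h
    congr 2
    · exact hflat 0 x
    · exact Finset.sum_congr rfl fun i _ => congrArg _ (hflat (c i) x)
end

section
/- Let C ∈ ℝ^{n×n} be a lower-triangular matrix with non-negative entries, let b and E be positive integers with n = b·E, let σ > 0, and let p be a positive integer. For each i ∈ {1,…,b}, let x^{(i)} ∈ ℝ^{n×p} be a matrix with ‖x^{(i)}[j,:]‖₂ ≤ 1 for j ∈ {i, b+i, …, (E−1)b+i} and x^{(i)}[j,:] = 0 for all other j. Define on ℝ^{np} the mixture M = (1/b)·Σ_{i=1}^b N(vec(C·x^{(i)}), σ²·I_{np}) and the Gaussian Q_{np} = N(0, σ²·I_{np}), and define on ℝ^n the mixture P = (1/b)·Σ_{i=1}^b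 N(m_i, σ²·I_n) with m_i = Σ_{ℓ=0}^{E−1} C[:, b·ℓ + i] and the Gaussian Q_n = N(0, σ²·I_n). Then for every α ≥ 0, H_α(M, Q_{np}) ≤ H_α(P, Q_n) and H_α(Q_{np}, M) ≤ H_α(Q_n, P). -/
open MeasureTheory

/-- The round `b·ℓ + i` (0-indexed) in which the example assigned to batch `i` participates
during epoch `ℓ`, as an element of `Fin (b·E)`. -/
def idx (b E : ℕ) (ℓ : Fin E) (i : Fin b) : Fin (b * E) :=
  ⟨b * ℓ.val + i.val, by
    have h1 := ℓ.isLt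
    have h2 := i.isLt
    calc b * ℓ.val + i.val < b * ℓ.val + b := by omega
      _ = b * (ℓ.val + 1) := by ring
      _ ≤ b * E := Nat.mul_le_mul_left b h1⟩

section

open ProbabilityTheory
open scoped NNReal ENNReal

theorem lintegral_pi_fin_succ {A : Type*} [MeasurableSpace A] (μ : Measure A) [SigmaFinite μ]
    {n : ℕ} {f : (Fin (n + 1) → A) → ℝ≥0∞} (hf : Measurable f) :
    ∫⁻ v, f v ∂(Measure.pi fun _ => μ) =
      ∫⁻ a, ∫⁻ v, f (Fin.cons a v) ∂(Measure.pi fun _ : Fin n => μ) ∂μ := by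
  have h := (measurePreserving_piFinSuccAbove (fun _ : Fin (n + 1) => μ) 0).symm
  rw [← h.lintegral_comp hf, lintegral_prod _ (by fun_prop)]
  simp [MeasurableEquiv.piFinSuccAbove, Fin.consEquiv]

theorem measurable_finCons {A : Type*} [MeasurableSpace A] {n : ℕ} :
    Measurable fun q : A × (Fin n → A) => (Fin.cons q.1 q.2 : Fin (n + 1) → A) := by
  simpa [MeasurableEquiv.piFinSuccAbove, Fin.consEquiv] using
    (MeasurableEquiv.piFinSuccAbove (fun _ : Fin (n + 1) => A) 0).symm.measurable

/-- Tensorization of the comparison of the expected excesses `E (∑ wᵢ Xᵢ - c)₊`. -/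
theorem lintegral_sum_prod_tsub_le {A B ι : Type*} [MeasurableSpace A] [MeasurableSpace B]
    [Fintype ι] (μ : Measure A) (ν : Measure B) [SigmaFinite μ] [SigmaFinite ν] {n : ℕ}
    (X : Fin n → ι → A → ℝ≥0) (Y : Fin n → ι → B → ℝ≥0)
    (hX : ∀ k i, Measurable (X k i)) (hY : ∀ k i, Measurable (Y k i))
    (h : ∀ k (w : ι → ℝ≥0) (c : ℝ≥0),
      ∫⁻ x, ↑(∑ i, w i * X k i x - c) ∂μ ≤ ∫⁻ y, ↑(∑ i, w i * Y k i y - c) ∂ν)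
    (w : ι → ℝ≥0) (c : ℝ≥0) :
    ∫⁻ x, ↑(∑ i, w i * ∏ k, X k i (x k) - c) ∂(Measure.pi fun _ => μ) ≤
      ∫⁻ y, ↑(∑ i, w i * ∏ k, Y k i (y k) - c) ∂(Measure.pi fun _ => ν) := by
  induction n generalizing w with
  | zero => simp
  | succ n ih =>
    rw [lintegral_pi_fin_succ μ (by fun_prop), lintegral_pi_fin_succ ν (by fun_prop)]
    simp only [Fin.prod_univ_succ, Fin.cons_zero, Fin.cons_succ]
    calc
      _ ≤ ∫⁻ a, ∫⁻ y, ↑(∑ i, w i * (X 0 i a * ∏ k : Fin n, Y k.succ i (y k)) - c)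
            ∂(Measure.pi fun _ => ν) ∂μ := by
        refine lintegral_mono fun a => ?_
        simpa only [mul_assoc] using ih (fun k => X k.succ) (fun k => Y k.succ)
          (fun k => hX k.succ) (fun k => hY k.succ) (fun k => h k.succ) (fun i => w i * X 0 i a)
      _ = ∫⁻ y, ∫⁻ a, ↑(∑ i, w i * (X 0 i a * ∏ k : Fin n, Y k.succ i (y k)) - c)
            ∂μ ∂(Measure.pi fun _ => ν) := lintegral_lintegral_swap (by fun_prop)
      _ ≤ ∫⁻ y, ∫⁻ b, ↑(∑ i, w i * (Y 0 i b * ∏ k : Fin n, Y k.succ i (y k)) - c)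
            ∂ν ∂(Measure.pi fun _ => ν) := by
        refine lintegral_mono fun y => ?_
        simpa only [mul_assoc, mul_comm, mul_left_comm] using
          h 0 (fun i => w i * ∏ k : Fin n, Y k.succ i (y k)) c
      _ = _ := lintegral_lintegral_swap (by fun_prop)

/-- The likelihood ratio `N(a, v) / N(0, v)` at `y`. -/
noncomputable def gaussRatio (v : ℝ≥0) (a y : ℝ) : ℝ≥0 :=
  Real.toNNReal (Real.exp ((a * y - a ^ 2 / 2) / v))

@[fun_prop]
theorem measurable_gaussRatio (v : ℝ≥0) (a : ℝ) : Measurable (gaussRatio v a) := by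
  unfold gaussRatio; fun_prop

theorem gaussRatio_mono (v : ℝ≥0) {a : ℝ} (ha : 0 ≤ a) : Monotone (gaussRatio v a) := by
  intro x y hxy
  unfold gaussRatio
  gcongr

@[simp]
theorem gaussRatio_zero (v : ℝ≥0) (y : ℝ) : gaussRatio v 0 y = 1 := by simp [gaussRatio]

theorem coe_gaussRatio (v : ℝ≥0) (a y : ℝ) :
    (gaussRatio v a y : ℝ) = Real.exp ((a * y - a ^ 2 / 2) / v) :=
  Real.coe_toNNReal _ (Real.exp_pos _).le

theorem lintegral_exp_gaussianReal (τ : ℝ≥0) :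
    ∫⁻ x, ↑(Real.toNNReal (Real.exp (x - τ / 2))) ∂(gaussianReal 0 τ) = 1 := by
  have h := mgf_fun_id_gaussianReal (μ := 0) (v := τ)
  have h1 := congrFun h 1
  have hi := integrable_exp_mul_gaussianReal (μ := 0) (v := τ) 1
  simp only [mgf, one_mul, zero_add, one_pow, mul_one] at h1 hi
  change ∫⁻ x, ENNReal.ofReal (Real.exp (x - τ / 2)) ∂(gaussianReal 0 τ) = 1
  simp_rw [Real.exp_sub]
  rw [← ofReal_integral_eq_lintegral_ofReal (hi.div_const _) (ae_of_all _ fun x => by positivity),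
    integral_div, h1, div_self (Real.exp_pos _).ne', ENNReal.ofReal_one]

/-- The expected excess of a normalized lognormal variable is monotone in its log-variance. -/
theorem lintegral_exp_gaussianReal_tsub_mono (d : ℝ≥0) :
    Monotone fun τ : ℝ≥0 =>
      ∫⁻ x, ↑(Real.toNNReal (Real.exp (x - τ / 2)) - d) ∂(gaussianReal 0 τ) := by
  intro τ τ' hle
  obtain ⟨ρ, rfl⟩ := exists_add_of_le hle
  have hconv := gaussianReal_conv_gaussianReal (m₁ := 0) (m₂ := 0) (v₁ := τ) (v₂ := ρ)
  rw [add_zero] at hconv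
  dsimp only
  rw [← hconv, Measure.lintegral_conv (by fun_prop)]
  refine lintegral_mono fun x => ?_
  have hint : ∫⁻ y, (↑(Real.toNNReal (Real.exp (x + y - ↑(τ + ρ) / 2))) : ℝ≥0∞)
      ∂(gaussianReal 0 ρ) = ↑(Real.toNNReal (Real.exp (x - τ / 2))) := by
    rw [← mul_one (ENNReal.ofNNReal (Real.toNNReal (Real.exp (x - τ / 2)))),
      ← lintegral_exp_gaussianReal ρ, ← lintegral_const_mul _ (by fun_prop)]
    refine lintegral_congr fun y => ?_
    rw [← ENNReal.coe_mul, ← Real.toNNReal_mul (Real.exp_pos _).le, ← Real.exp_add]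
    congr 3
    push_cast
    ring
  rw [ENNReal.coe_sub, ← hint]
  simp_rw [ENNReal.coe_sub]
  refine le_trans (le_of_eq ?_) (lintegral_sub_le (fun _ => (d : ℝ≥0∞)) _ (by fun_prop))
  simp

theorem map_sum_mul_pi_gaussianReal {p : ℕ} (v : ℝ≥0) (u : Fin p → ℝ) :
    (Measure.pi fun _ : Fin p => gaussianReal 0 v).map (fun y => ∑ t, u t / v * y t) =
      gaussianReal 0 (∑ t, Real.toNNReal ((u t / v) ^ 2) * v) := by
  have hmap (t : Fin p) :
      (Measure.pi fun _ : Fin p => gaussianReal 0 v).map (fun y => u t / v * y t) =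
        gaussianReal 0 (Real.toNNReal ((u t / v) ^ 2) * v) := by
    rw [show (fun y : Fin p → ℝ => u t / v * y t) =
        (fun r => u t / v * r) ∘ Function.eval t from rfl,
      ← Measure.map_map (by fun_prop) (by fun_prop),
      (measurePreserving_eval (fun _ : Fin p => gaussianReal 0 v) t).map_eq,
      gaussianReal_map_const_mul, mul_zero, Real.toNNReal_of_nonneg (sq_nonneg _)]
  have hind : iIndepFun (fun t (y : Fin p → ℝ) => u t / v * y t)
      (Measure.pi fun _ : Fin p => gaussianReal 0 v) :=
    iIndepFun_pi (X := fun t r => u t / v * r) fun t => (measurable_const_mul _).aemeasurable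
  apply Measure.ext_of_charFun
  rw [hind.charFun_map_fun_sum_eq_prod (fun t => (by fun_prop : Measurable _).aemeasurable)]
  ext s
  simp only [hmap, Finset.prod_apply, charFun_gaussianReal, ← Complex.exp_sum]
  congr 1
  simp [Finset.sum_mul, Finset.sum_div]

theorem prod_gaussRatio {p : ℕ} (v : ℝ≥0) (u y : Fin p → ℝ) :
    ∏ t, gaussRatio v (u t) (y t) =
      Real.toNNReal (Real.exp (∑ t, u t / v * y t - (∑ t, u t ^ 2) / v / 2)) := by
  rw [← NNReal.coe_inj, NNReal.coe_prod, Real.coe_toNNReal _ (Real.exp_pos _).le]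
  simp_rw [coe_gaussRatio]
  rw [← Real.exp_sum, Finset.sum_div, Finset.sum_div, ← Finset.sum_sub_distrib]
  congr 1
  refine Finset.sum_congr rfl fun t _ => ?_
  ring

theorem lintegral_prod_gaussRatio_tsub {p : ℕ} {v : ℝ≥0} (hv : v ≠ 0) (u : Fin p → ℝ)
    (d : ℝ≥0) :
    ∫⁻ y, ↑(∏ t, gaussRatio v (u t) (y t) - d) ∂(Measure.pi fun _ => gaussianReal 0 v) =
      ∫⁻ x, ↑(Real.toNNReal (Real.exp (x - ↑(Real.toNNReal (∑ t, u t ^ 2) / v) / 2)) - d)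
        ∂(gaussianReal 0 (Real.toNNReal (∑ t, u t ^ 2) / v)) := by
  have hvar : ∑ t, Real.toNNReal ((u t / v) ^ 2) * v = Real.toNNReal (∑ t, u t ^ 2) / v := by
    have hv' : (v : ℝ) ≠ 0 := by exact_mod_cast hv
    rw [← NNReal.coe_inj]
    push_cast
    rw [Real.coe_toNNReal _ (Finset.sum_nonneg fun t _ => sq_nonneg _), Finset.sum_div]
    refine Finset.sum_congr rfl fun t _ => ?_
    rw [Real.coe_toNNReal _ (sq_nonneg _)]
    field_simp
  rw [← hvar, ← map_sum_mul_pi_gaussianReal, lintegral_map (by fun_prop) (by fun_prop), hvar]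
  refine lintegral_congr fun y => ?_
  rw [prod_gaussRatio, NNReal.coe_div,
    Real.coe_toNNReal _ (Finset.sum_nonneg fun t _ => sq_nonneg _)]

theorem lintegral_gaussRatio_tsub {v : ℝ≥0} (hv : v ≠ 0) (a : ℝ) (d : ℝ≥0) :
    ∫⁻ y, ↑(gaussRatio v a y - d) ∂(gaussianReal 0 v) =
      ∫⁻ x, ↑(Real.toNNReal (Real.exp (x - ↑(Real.toNNReal (a ^ 2) / v) / 2)) - d)
        ∂(gaussianReal 0 (Real.toNNReal (a ^ 2) / v)) := by
  have h := lintegral_prod_gaussRatio_tsub hv (fun _ : Fin 1 => a) d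
  simp only [Finset.univ_unique, Finset.prod_singleton, Finset.sum_singleton] at h
  rw [← h, ← (measurePreserving_eval (fun _ : Fin 1 => gaussianReal 0 v) default).lintegral_comp
    (f := fun y => ↑(gaussRatio v a y - d)) (by fun_prop)]

theorem lintegral_prod_gaussRatio_tsub_le {p : ℕ} {v : ℝ≥0} (hv : v ≠ 0) {u : Fin p → ℝ} {a : ℝ}
    (hua : ∑ t, u t ^ 2 ≤ a ^ 2) (d : ℝ≥0) :
    ∫⁻ y, ↑(∏ t, gaussRatio v (u t) (y t) - d) ∂(Measure.pi fun _ => gaussianReal 0 v) ≤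
      ∫⁻ y, ↑(gaussRatio v a y - d) ∂(gaussianReal 0 v) := by
  rw [lintegral_prod_gaussRatio_tsub hv, lintegral_gaussRatio_tsub hv]
  exact lintegral_exp_gaussianReal_tsub_mono d (by gcongr)

/-- The comonotone sum of normalized lognormal variables maximizes the expected excess over any
level among all sums whose terms have smaller expected excesses. -/
theorem lintegral_sum_tsub_le_gaussRatio {A ι : Type*} [MeasurableSpace A] [Fintype ι]
    (μ : Measure A) [IsProbabilityMeasure μ] {v : ℝ≥0} (hv : v ≠ 0) {a : ι → ℝ}
    (ha : ∀ i, 0 ≤ a i) {X : ι → A → ℝ≥0} (hX : ∀ i, Measurable (X i))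
    (hX1 : ∀ i, a i = 0 → ∀ x, X i x = 1)
    (hle : ∀ i (d : ℝ≥0), ∫⁻ x, ↑(X i x - d) ∂μ ≤
      ∫⁻ y, ↑(gaussRatio v (a i) y - d) ∂(gaussianReal 0 v))
    (w : ι → ℝ≥0) (c : ℝ≥0) :
    ∫⁻ x, ↑(∑ i, w i * X i x - c) ∂μ ≤
      ∫⁻ y, ↑(∑ i, w i * gaussRatio v (a i) y - c) ∂(gaussianReal 0 v) := by
  have hv' : (0 : ℝ) < v := by exact_mod_cast pos_iff_ne_zero.2 hv
  have hcont (i) : Continuous (gaussRatio v (a i)) := by unfold gaussRatio; fun_prop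
  have hG : Continuous fun y => ∑ i, w i * gaussRatio v (a i) y := by fun_prop
  by_cases hy : ∃ y₀, ∑ i, w i * gaussRatio v (a i) y₀ = c
  · obtain ⟨y₀, rfl⟩ := hy
    calc
      _ ≤ ∫⁻ x, ∑ i, (w i : ℝ≥0∞) * ↑(X i x - gaussRatio v (a i) y₀) ∂μ := by
        refine lintegral_mono fun x => ?_
        norm_cast
        refine ENNReal.coe_le_coe.2 ?_
        rw [tsub_le_iff_right, ← Finset.sum_add_distrib]
        refine Finset.sum_le_sum fun i _ => ?_
        rw [← mul_add]
        gcongr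
        exact le_tsub_add
      _ = ∑ i, (w i : ℝ≥0∞) * ∫⁻ x, ↑(X i x - gaussRatio v (a i) y₀) ∂μ := by
        rw [lintegral_finsetSum _ fun i _ => by fun_prop]
        exact Finset.sum_congr rfl fun i _ => lintegral_const_mul _ (by fun_prop)
      _ ≤ ∑ i, (w i : ℝ≥0∞) *
          ∫⁻ y, ↑(gaussRatio v (a i) y - gaussRatio v (a i) y₀) ∂(gaussianReal 0 v) := by
        gcongr with i
        exact hle i _
      _ = ∫⁻ y, ∑ i, (w i : ℝ≥0∞) * ↑(gaussRatio v (a i) y - gaussRatio v (a i) y₀)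
          ∂(gaussianReal 0 v) := by
        rw [lintegral_finsetSum _ fun i _ => by fun_prop]
        exact Finset.sum_congr rfl fun i _ => (lintegral_const_mul _ (by fun_prop)).symm
      _ ≤ _ := by
        refine lintegral_mono fun y => ?_
        norm_cast
        refine ENNReal.coe_le_coe.2 ?_
        rcases le_total y y₀ with h | h
        · simp [tsub_eq_zero_of_le (gaussRatio_mono v (ha _) h)]
        · refine le_tsub_of_add_le_right ?_
          rw [← Finset.sum_add_distrib]
          refine Finset.sum_le_sum fun i _ => ?_
          rw [← mul_add, tsub_add_cancel_of_le (gaussRatio_mono v (ha i) h)]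
  · have hdich : (∀ y, c < ∑ i, w i * gaussRatio v (a i) y) ∨
        ∀ y, ∑ i, w i * gaussRatio v (a i) y < c := by
      by_contra! hcon
      obtain ⟨⟨y₁, h₁⟩, y₂, h₂⟩ := hcon
      exact hy (mem_range_of_exists_le_of_exists_ge hG ⟨y₁, h₁⟩ ⟨y₂, h₂⟩)
    rcases hdich with hlt | hlt
    · have hlim : Filter.Tendsto (fun y => ∑ i, w i * gaussRatio v (a i) y) Filter.atBot
          (nhds (∑ i, w i * if a i = 0 then 1 else 0)) := by
        refine tendsto_finsetSum _ fun i _ => Filter.Tendsto.const_mul _ ?_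
        split_ifs with h0
        · simp [h0, funext (gaussRatio_zero v)]
        · have hpos : 0 < a i := lt_of_le_of_ne (ha i) (Ne.symm h0)
          unfold gaussRatio
          rw [← Real.toNNReal_zero]
          refine tendsto_real_toNNReal (Real.tendsto_exp_atBot.comp ?_)
          refine Filter.Tendsto.atBot_div_const hv' ?_
          exact Filter.tendsto_atBot_add_const_right _ _
            (Filter.tendsto_id.const_mul_atBot hpos)
      have hc : c ≤ ∑ i, w i * if a i = 0 then 1 else 0 :=
        ge_of_tendsto' hlim fun y => (hlt y).le
      have hmean : ∫⁻ x, ↑(∑ i, w i * X i x) ∂μ ≤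
          ∫⁻ y, ↑(∑ i, w i * gaussRatio v (a i) y) ∂(gaussianReal 0 v) := by
        push_cast
        rw [lintegral_finsetSum _ fun i _ => by fun_prop,
          lintegral_finsetSum _ fun i _ => by fun_prop]
        refine Finset.sum_le_sum fun i _ => ?_
        rw [lintegral_const_mul _ (by fun_prop), lintegral_const_mul _ (by fun_prop)]
        refine mul_le_mul_right ?_ _
        simpa only [tsub_zero] using hle i 0
      simp_rw [ENNReal.coe_sub]
      rw [lintegral_sub measurable_const (by simp), lintegral_sub measurable_const (by simp)]
      · simpa only [lintegral_const, measure_univ] using tsub_le_tsub_right hmean _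
      · exact ae_of_all _ fun y => ENNReal.coe_le_coe.2 (hlt y).le
      · refine ae_of_all _ fun x => ENNReal.coe_le_coe.2 ?_
        refine hc.trans (Finset.sum_le_sum fun i _ => ?_)
        gcongr
        split_ifs with h0
        · rw [hX1 i h0]
        · exact zero_le
    · have hw (i) (h0 : a i ≠ 0) : w i = 0 := by
        by_contra hwi
        have hwi' : (0 : ℝ) < w i := by exact_mod_cast pos_iff_ne_zero.2 hwi
        have hpos : 0 < a i := lt_of_le_of_ne (ha i) (Ne.symm h0)
        have h1 : w i * gaussRatio v (a i) ((c / w i * v + a i ^ 2 / 2) / a i) < c :=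
          (Finset.single_le_sum (f := fun i => w i * gaussRatio v (a i) _)
            (fun _ _ => zero_le) (Finset.mem_univ i)).trans_lt (hlt _)
        rw [← NNReal.coe_lt_coe, NNReal.coe_mul, coe_gaussRatio, mul_div_cancel₀ _ h0,
          add_sub_cancel_right, mul_div_cancel_right₀ _ hv'.ne'] at h1
        have h2 := Real.add_one_le_exp (c / w i : ℝ)
        have h3 : (w i : ℝ) * (c / w i + 1) ≤ w i * Real.exp (c / w i) := by gcongr
        have h4 : (w i : ℝ) * (c / w i + 1) = c + w i := by field_simp
        linarith
      have hzero (x) : ∑ i, w i * X i x - c = 0 := by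
        refine tsub_eq_zero_of_le (le_of_eq_of_le ?_ (hlt 0).le)
        refine Finset.sum_congr rfl fun i _ => ?_
        by_cases h0 : a i = 0
        · simp [hX1 i h0, h0]
        · simp [hw i h0]
      simp [hzero]

theorem lintegral_rows_gaussRatio_le {n p : ℕ} {ι : Type*} [Fintype ι] {v : ℝ≥0} (hv : v ≠ 0)
    (U : ι → Fin n → Fin p → ℝ) (a : ι → Fin n → ℝ) (ha : ∀ i k, 0 ≤ a i k)
    (hUa : ∀ i k, ∑ t, U i k t ^ 2 ≤ a i k ^ 2) (w : ι → ℝ≥0) (c : ℝ≥0) :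
    ∫⁻ y : Fin n → Fin p → ℝ, ↑(∑ i, w i * ∏ k, ∏ t, gaussRatio v (U i k t) (y k t) - c)
        ∂(Measure.pi fun _ => Measure.pi fun _ => gaussianReal 0 v) ≤
      ∫⁻ y, ↑(∑ i, w i * ∏ k, gaussRatio v (a i k) (y k) - c)
        ∂(Measure.pi fun _ => gaussianReal 0 v) := by
  refine lintegral_sum_prod_tsub_le (Measure.pi fun _ => gaussianReal 0 v) (gaussianReal 0 v)
    (fun k i y => ∏ t, gaussRatio v (U i k t) (y t)) (fun k i => gaussRatio v (a i k))
    (fun k i => by fun_prop) (fun k i => by fun_prop) (fun k w c => ?_) w c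
  refine lintegral_sum_tsub_le_gaussRatio _ hv (fun i => ha i k) (fun i => by fun_prop)
    (fun i h0 y => ?_) (fun i d => lintegral_prod_gaussRatio_tsub_le hv (hUa i k) d) w c
  have hzero : ∀ t, U i k t = 0 := by
    have h := hUa i k
    rw [h0, zero_pow two_ne_zero] at h
    intro t
    have := Finset.single_le_sum (f := fun t => U i k t ^ 2) (fun _ _ => sq_nonneg _)
      (Finset.mem_univ t)
    exact pow_eq_zero_iff two_ne_zero |>.1 (le_antisymm (this.trans h) (sq_nonneg _))
  simp [hzero]

theorem lintegral_pi_gaussianReal {d : ℕ} {v : ℝ≥0} (hv : v ≠ 0) {F : (Fin d → ℝ) → ℝ≥0∞}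
    (hF : Measurable F) :
    ∫⁻ y, (∏ t, gaussianPDF 0 v (y t)) * F y =
      ∫⁻ y, F y ∂(Measure.pi fun _ => gaussianReal 0 v) := by
  rw [volume_pi]
  induction d with
  | zero => simp [Measure.pi_of_empty fun _ : Fin 0 => _]
  | succ d ih =>
    have hdens {g : ℝ → ℝ≥0∞} (hg : Measurable g) :
        ∫⁻ a, g a ∂gaussianReal 0 v = ∫⁻ a, (gaussianPDF 0 v * g) a := by
      rw [gaussianReal_of_var_ne_zero 0 hv,
        lintegral_withDensity_eq_lintegral_mul _ (by fun_prop) hg]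
    have := measurable_finCons (A := ℝ) (n := d)
    rw [lintegral_pi_fin_succ _ (by fun_prop), lintegral_pi_fin_succ _ hF,
      hdens (Measurable.lintegral_prod_right'
        (f := fun q : ℝ × (Fin d → ℝ) => F (Fin.cons q.1 q.2)) (by fun_prop))]
    refine lintegral_congr fun a => ?_
    have : Measurable fun y : Fin d → ℝ => (Fin.cons a y : Fin (d + 1) → ℝ) :=
      this.comp measurable_prodMk_left
    simp only [Fin.prod_univ_succ, Fin.cons_zero, Fin.cons_succ, mul_assoc, Pi.mul_apply]
    rw [lintegral_const_mul _ (by fun_prop), ih (F := fun y => F (Fin.cons a y)) (by fun_prop)]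

theorem gaussDensity_eq_prod (d : ℕ) {σ : ℝ} {v : ℝ≥0} (hv : (v : ℝ) = σ ^ 2)
    (m x : EuclideanSpace ℝ (Fin d)) :
    gaussDensity d σ m x = ∏ t, gaussianPDFReal (m t) v (x t) := by
  simp only [gaussDensity, gaussianPDFReal, Finset.prod_mul_distrib, ← Real.exp_sum, hv]
  congr 1
  · rw [Finset.prod_const, Finset.card_univ, Fintype.card_fin, Real.sqrt_eq_rpow,
      ← Real.rpow_neg (by positivity), ← Real.rpow_natCast _ d,
      ← Real.rpow_mul (by positivity)]
    congr 1
    ring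
  · rw [EuclideanSpace.real_norm_sq_eq, ← Finset.sum_div, Finset.sum_neg_distrib]
    simp

theorem gaussDensity_eq_mul_gaussRatio (d : ℕ) {σ : ℝ} {v : ℝ≥0} (hv : (v : ℝ) = σ ^ 2)
    (m x : EuclideanSpace ℝ (Fin d)) :
    gaussDensity d σ m x = gaussDensity d σ 0 x * ↑(∏ t, gaussRatio v (m t) (x t)) := by
  rw [gaussDensity_eq_prod d hv, gaussDensity_eq_prod d hv, NNReal.coe_prod,
    ← Finset.prod_mul_distrib]
  refine Finset.prod_congr rfl fun t _ => ?_
  rw [coe_gaussRatio, gaussianPDFReal, gaussianPDFReal, mul_assoc (_)⁻¹, ← Real.exp_add]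
  congr 2
  simp only [PiLp.zero_apply]
  ring

theorem ofReal_gaussDensity_zero (d : ℕ) {σ : ℝ} {v : ℝ≥0} (hv : (v : ℝ) = σ ^ 2)
    (x : EuclideanSpace ℝ (Fin d)) :
    ENNReal.ofReal (gaussDensity d σ 0 x) = ∏ t, gaussianPDF 0 v (x t) := by
  rw [gaussDensity_eq_prod d hv, ENNReal.ofReal_prod_of_nonneg fun t _ =>
    gaussianPDFReal_nonneg _ _ _]
  rfl

theorem lintegral_ofReal_gaussDensity_sub {ι : Type*} [Fintype ι] (d : ℕ) {σ : ℝ} {v : ℝ≥0}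
    (hv : (v : ℝ) = σ ^ 2) (hv0 : v ≠ 0) (M : ι → EuclideanSpace ℝ (Fin d)) (w : ι → ℝ≥0)
    (c : ℝ≥0) :
    ∫⁻ x, ENNReal.ofReal (∑ i, w i * gaussDensity d σ (M i) x - c * gaussDensity d σ 0 x) =
      ∫⁻ y, ↑(∑ i, w i * ∏ t, gaussRatio v (M i t) (y t) - c)
        ∂(Measure.pi fun _ => gaussianReal 0 v) := by
  rw [← lintegral_pi_gaussianReal hv0 (by fun_prop),
    ← (PiLp.volume_preserving_ofLp (Fin d)).lintegral_comp (by fun_prop)]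
  refine lintegral_congr fun x => ?_
  rw [← ofReal_gaussDensity_zero d hv, ← ENNReal.ofReal_coe_nnreal, NNReal.coe_sub_def,
    ENNReal.ofReal_max, ENNReal.ofReal_zero, max_eq_left zero_le, ← ENNReal.ofReal_mul
    (by unfold gaussDensity; positivity)]
  congr 1
  simp_rw [gaussDensity_eq_mul_gaussRatio d hv (M _)]
  push_cast
  rw [mul_sub, Finset.mul_sum, mul_comm _ (c : ℝ)]
  congr 1
  exact Finset.sum_congr rfl fun i _ => by ring

theorem lintegral_ofReal_gaussDensity (d : ℕ) {σ : ℝ} (hσ : σ ≠ 0)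
    (m : EuclideanSpace ℝ (Fin d)) :
    ∫⁻ x, ENNReal.ofReal (gaussDensity d σ m x) = 1 := by
  have hv : ((Real.toNNReal (σ ^ 2) : ℝ≥0) : ℝ) = σ ^ 2 := Real.coe_toNNReal _ (sq_nonneg _)
  have hv0 : Real.toNNReal (σ ^ 2) ≠ 0 := by
    rw [← NNReal.coe_ne_zero, hv]
    positivity
  have h := lintegral_sub_right_eq_self (μ := volume)
    (fun x => ENNReal.ofReal (gaussDensity d σ 0 x)) m
  have h1 := lintegral_ofReal_gaussDensity_sub d hv hv0 (fun _ : Fin 1 => 0) (fun _ => 1) 0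
  simp only [gaussDensity, sub_zero] at h h1 ⊢
  rw [h]
  simpa using h1

theorem integrable_gaussDensity (d : ℕ) {σ : ℝ} (hσ : σ ≠ 0) (m : EuclideanSpace ℝ (Fin d)) :
    Integrable (gaussDensity d σ m) := by
  have hmeas : Measurable (gaussDensity d σ m) := by unfold gaussDensity; fun_prop
  refine ⟨hmeas.aestronglyMeasurable, ?_⟩
  rw [hasFiniteIntegral_iff_ofReal (ae_of_all _ fun x => by unfold gaussDensity; positivity),
    lintegral_ofReal_gaussDensity d hσ]
  exact ENNReal.one_lt_top

theorem integral_gaussDensity (d : ℕ) {σ : ℝ} (hσ : σ ≠ 0) (m : EuclideanSpace ℝ (Fin d)) :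
    ∫ x, gaussDensity d σ m x = 1 := by
  rw [integral_eq_lintegral_of_nonneg_ae (ae_of_all _ fun x => by unfold gaussDensity; positivity)
    (integrable_gaussDensity d hσ m).aestronglyMeasurable, lintegral_ofReal_gaussDensity d hσ,
    ENNReal.toReal_one]

theorem measurePreserving_uncurry_finProdFinEquiv (n p : ℕ) (γ : Measure ℝ)
    [IsProbabilityMeasure γ] :
    MeasurePreserving (fun (y : Fin n → Fin p → ℝ) (t : Fin (n * p)) =>
        y (finProdFinEquiv.symm t).1 (finProdFinEquiv.symm t).2)
      (Measure.pi fun _ => Measure.pi fun _ => γ) (Measure.pi fun _ => γ) := by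
  have h1 : MeasurePreserving (MeasurableEquiv.curry (Fin n) (Fin p) ℝ).symm
      (Measure.pi fun _ => Measure.pi fun _ => γ) (Measure.pi fun _ => γ) := by
    refine ⟨MeasurableEquiv.measurable _, ?_⟩
    simpa only [Measure.infinitePi_eq_pi] using
      Measure.infinitePi_map_curry_symm (ι := Fin n) (κ := Fin p) fun _ _ => γ
  have h2 := measurePreserving_piCongrLeft (fun _ : Fin (n * p) => γ) finProdFinEquiv
  convert! h2.comp h1 using 1
  ext y t
  obtain ⟨q, rfl⟩ := finProdFinEquiv.surjective t
  simp [MeasurableEquiv.piCongrLeft, MeasurableEquiv.curry, Equiv.piCongrLeft_apply_apply,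
    Function.uncurry_def]

theorem sum_sq_mul_row_le {n p : ℕ} {ι : Type*} [Fintype ι] (C : Matrix (Fin n) (Fin n) ℝ)
    (hC : ∀ k j, 0 ≤ C k j) (X : Matrix (Fin n) (Fin p) ℝ) {f : ι → Fin n}
    (hf : Function.Injective f) (hX1 : ∀ l, Real.sqrt (∑ t, X (f l) t ^ 2) ≤ 1)
    (hX0 : ∀ j, (∀ l, j ≠ f l) → X j = 0) (k : Fin n) :
    ∑ t, (C * X) k t ^ 2 ≤ (∑ l, C k (f l)) ^ 2 := by
  classical
  have hsum : WithLp.toLp 2 ((C * X) k) = ∑ l, C k (f l) • WithLp.toLp 2 (X (f l)) := by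
    ext t
    simp only [Matrix.mul_apply, WithLp.ofLp_sum, WithLp.ofLp_smul, Finset.sum_apply,
      Pi.smul_apply, smul_eq_mul]
    rw [← Finset.sum_image (f := fun j => C k j * X j t) hf.injOn]
    refine (Finset.sum_subset (Finset.subset_univ _) fun j _ hj => ?_).symm
    rw [hX0 j fun l hl => hj (by simp [hl]), Pi.zero_apply, mul_zero]
  have hnorm : ‖WithLp.toLp 2 ((C * X) k)‖ ≤ ∑ l, C k (f l) := by
    rw [hsum]
    refine (norm_sum_le _ _).trans (Finset.sum_le_sum fun l _ => ?_)
    rw [norm_smul, Real.norm_of_nonneg (hC _ _)]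
    refine mul_le_of_le_one_right (hC _ _) ?_
    rw [EuclideanSpace.norm_eq]
    simpa using hX1 l
  have h := pow_le_pow_left₀ (norm_nonneg _) hnorm 2
  rwa [EuclideanSpace.real_norm_sq_eq] at h

theorem vec_finProdFinEquiv {n p : ℕ} (M : Matrix (Fin n) (Fin p) ℝ) (q : Fin n × Fin p) :
    vec M (finProdFinEquiv q) = M q.1 q.2 := by
  change M (finProdFinEquiv.symm (finProdFinEquiv q)).1 _ = _
  rw [Equiv.symm_apply_apply]

/-- If the rows of the matrices `N i` have norms at most the coordinates of `m i`, then the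
mixture with means `vec (N i)` has smaller excess over the centered Gaussian than the mixture
with means `m i`. -/
theorem integral_max_mixture_sub_le {n p : ℕ} {ι : Type*} [Fintype ι] {σ : ℝ} (hσ : σ ≠ 0)
    (N : ι → Matrix (Fin n) (Fin p) ℝ) (m : ι → EuclideanSpace ℝ (Fin n))
    (hm : ∀ i k, 0 ≤ m i k) (hN : ∀ i k, ∑ t, N i k t ^ 2 ≤ m i k ^ 2) {w c : ℝ} (hw : 0 ≤ w)
    (hc : 0 ≤ c) :
    ∫ x, max (w * ∑ i, gaussDensity (n * p) σ (vec (N i)) x - c * gaussDensity (n * p) σ 0 x) 0 ≤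
      ∫ y, max (w * ∑ i, gaussDensity n σ (m i) y - c * gaussDensity n σ 0 y) 0 := by
  lift w to ℝ≥0 using hw
  lift c to ℝ≥0 using hc
  have hv : ((Real.toNNReal (σ ^ 2) : ℝ≥0) : ℝ) = σ ^ 2 := Real.coe_toNNReal _ (sq_nonneg _)
  have hv0 : Real.toNNReal (σ ^ 2) ≠ 0 := by
    rw [← NNReal.coe_ne_zero, hv]
    positivity
  have hint (d : ℕ) (M : ι → EuclideanSpace ℝ (Fin d)) : Integrable fun x =>
      ∑ i, (w : ℝ) * gaussDensity d σ (M i) x - c * gaussDensity d σ 0 x :=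
    (integrable_finsetSum _ fun i _ => (integrable_gaussDensity d hσ _).const_mul _).sub
      ((integrable_gaussDensity d hσ _).const_mul _)
  have hlint (d : ℕ) (M : ι → EuclideanSpace ℝ (Fin d)) :
      ∫ x, max (∑ i, (w : ℝ) * gaussDensity d σ (M i) x - c * gaussDensity d σ 0 x) 0 =
        (∫⁻ x, ENNReal.ofReal
          (∑ i, (w : ℝ) * gaussDensity d σ (M i) x - c * gaussDensity d σ 0 x)).toReal := by
    refine (integral_eq_lintegral_of_nonneg_ae (ae_of_all _ fun x => le_max_right _ _)
      (hint d M).pos_part.aestronglyMeasurable).trans ?_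
    simp only [ENNReal.ofReal_max, Pi.zero_apply, ENNReal.ofReal_zero, max_eq_left zero_le]
  simp_rw [Finset.mul_sum]
  rw [hlint, hlint]
  refine ENNReal.toReal_mono (hint n m).lintegral_lt_top.ne ?_
  rw [lintegral_ofReal_gaussDensity_sub _ hv hv0 _ (fun _ => w),
    lintegral_ofReal_gaussDensity_sub _ hv hv0 _ (fun _ => w),
    ← (measurePreserving_uncurry_finProdFinEquiv n p _).lintegral_comp (by fun_prop)]
  refine le_of_eq_of_le (lintegral_congr fun y => ?_)
    (lintegral_rows_gaussRatio_le hv0 N (fun i k => m i k) hm hN (fun _ => w) c)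
  congr! 4 with i
  rw [← finProdFinEquiv.prod_comp, Fintype.prod_prod_type]
  simp only [vec_finProdFinEquiv, Equiv.symm_apply_apply]

theorem integral_max_sub_mixture_eq {d : ℕ} {ι : Type*} [Fintype ι] {σ : ℝ} (hσ : σ ≠ 0)
    (M : ι → EuclideanSpace ℝ (Fin d)) (w : ℝ) :
    ∫ x, max (gaussDensity d σ 0 x - w * ∑ i, gaussDensity d σ (M i) x) 0 =
      (∫ x, max (w * ∑ i, gaussDensity d σ (M i) x - 1 * gaussDensity d σ 0 x) 0) +
        (1 - w * Fintype.card ι) := by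
  have h0 := integrable_gaussDensity d hσ 0
  have hM : Integrable fun x => w * ∑ i, gaussDensity d σ (M i) x :=
    (integrable_finsetSum _ fun i _ => integrable_gaussDensity d hσ _).const_mul _
  have hd : ∫ x, (gaussDensity d σ 0 x - w * ∑ i, gaussDensity d σ (M i) x) =
      1 - w * Fintype.card ι := by
    rw [integral_sub h0 hM, integral_gaussDensity d hσ, integral_const_mul,
      integral_finsetSum _ fun i _ => integrable_gaussDensity d hσ _]
    simp [integral_gaussDensity d hσ]
  rw [← hd]
  refine .trans (integral_congr_ae (ae_of_all _ fun x => ?_))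
    (integral_add (hM.sub (h0.const_mul 1)).pos_part (h0.sub hM))
  dsimp only
  rw [max_add, max_comm]
  congr 1 <;> ring

theorem idx_injective (b E : ℕ) (i : Fin b) : Function.Injective fun ℓ => idx b E ℓ i := by
  intro ℓ ℓ' h
  have hb : 0 < b := i.pos
  simpa [idx, hb.ne', Fin.ext_iff] using h

end

/-- **Dimension-reduction core of the dominating-pair lemma for balls-in-bins batching
(Lemma `bib-dim-red`).** Let `C ∈ ℝ^{n×n}` (`n = b·E`) be lower triangular with non-negative
entries, `σ > 0`, and for each batch `i` let `x i ∈ ℝ^{n×p}` have rows of norm at most `1` in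
rounds `b·ℓ + i` and zero rows elsewhere. With
`M = (1/b)·∑ i, N(vec (C·x i), σ²·I_{np})`, `Q_{np} = N(0, σ²·I_{np})`,
`P = (1/b)·∑ i, N(m i, σ²·I_n)` where `m i = ∑_{ℓ<E} C[:, b·ℓ+i]`, and `Q_n = N(0, σ²·I_n)`,
for every `α ≥ 0` we have `H_α(M, Q_{np}) ≤ H_α(P, Q_n)` and `H_α(Q_{np}, M) ≤ H_α(Q_n, P)`. -/
theorem ballsInBins_dominating_pair_dimension_reduction
    (b E p : ℕ) (hb : 0 < b) (hE : 0 < E) (hp : 0 < p) (σ : ℝ) (hσ : 0 < σ)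
    (C : Matrix (Fin (b * E)) (Fin (b * E)) ℝ)
    (hlower : ∀ k j : Fin (b * E), k < j → C k j = 0)
    (hnonneg : ∀ k j : Fin (b * E), 0 ≤ C k j)
    (x : Fin b → Matrix (Fin (b * E)) (Fin p) ℝ)
    (hx1 : ∀ i (ℓ : Fin E), Real.sqrt (∑ t, (x i (idx b E ℓ i) t) ^ 2) ≤ 1)
    (hx0 : ∀ i (j : Fin (b * E)), (∀ ℓ : Fin E, j ≠ idx b E ℓ i) → x i j = 0)
    (m : Fin b → EuclideanSpace ℝ (Fin (b * E)))
    (hm : ∀ i, m i = (EuclideanSpace.equiv (Fin (b * E)) ℝ).symm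
      fun k => ∑ ℓ : Fin E, C k (idx b E ℓ i))
    (α : ℝ) (hα : 0 ≤ α) :
    ((∫ v, max ((1 / (b : ℝ)) * ∑ i, gaussDensity ((b * E) * p) σ (vec (C * x i)) v -
          α * gaussDensity ((b * E) * p) σ 0 v) 0) ≤
        ∫ y, max ((1 / (b : ℝ)) * ∑ i, gaussDensity (b * E) σ (m i) y -
          α * gaussDensity (b * E) σ 0 y) 0) ∧
      ((∫ v, max (gaussDensity ((b * E) * p) σ 0 v -
          α * ((1 / (b : ℝ)) * ∑ i, gaussDensity ((b * E) * p) σ (vec (C * x i)) v)) 0) ≤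
        ∫ y, max (gaussDensity (b * E) σ 0 y -
          α * ((1 / (b : ℝ)) * ∑ i, gaussDensity (b * E) σ (m i) y)) 0) := by
  have hnn (i k) : 0 ≤ m i k := by
    rw [hm]
    change 0 ≤ ∑ ℓ, C k (idx b E ℓ i)
    exact Finset.sum_nonneg fun _ _ => hnonneg _ _
  have hN (i k) : ∑ t, (C * x i) k t ^ 2 ≤ m i k ^ 2 := by
    rw [hm]
    exact sum_sq_mul_row_le C hnonneg (x i) (idx_injective b E i) (hx1 i) (hx0 i) k
  refine ⟨integral_max_mixture_sub_le hσ.ne' _ m hnn hN (by positivity) hα, ?_⟩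
  simp_rw [← mul_assoc α]
  rw [integral_max_sub_mixture_eq hσ.ne', integral_max_sub_mixture_eq hσ.ne']
  gcongr
  exact integral_max_mixture_sub_le hσ.ne' _ m hnn hN (by positivity) zero_le_one
end
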